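/- Fix α ∈ (0,1) and let X, Y be d×d complex Hermitian positive definite matrices with tr X = tr Y = 1. Writing d_X := tr(X^α) and δ_t²(X,Y) := (1/2)·(1/(t+d_X) + 1/(t+d_Y)) − 1/(t + d_{(X+Y)/2}) for t ≥ 0, one has QJRD_α(X,Y) = (1/(1−α)) · ∫₀^∞ δ_t²(X,Y) dt. -/

import Mathlib

open MeasureTheory Matrix
open scoped ComplexOrder

/-- `tr g(X)` for a Hermitian matrix `X`: the sum of `g` over the eigenvalues of `X`. -/
noncomputable def traceF {d : ℕ} (g : ℝ → ℝ) (X : Matrix (Fin d) (Fin d) ℂ) : ℝ :=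
  if hX : X.IsHermitian then ∑ i, g (hX.eigenvalues i) else 0

/-- The quantum Rényi entropy `H_α(X) = (1/(1−α))·log(tr(X^α)/tr(X))`. -/
noncomputable def renyiEntropy {d : ℕ} (α : ℝ) (X : Matrix (Fin d) (Fin d) ℂ) : ℝ :=
  (1 / (1 - α)) * Real.log (traceF (fun x => x ^ α) X / X.trace.re)

/-- The quantum Jensen-Rényi divergence
`QJRD_α(X,Y) = H_α((X+Y)/2) − (1/2)H_α(X) − (1/2)H_α(Y)`. -/
noncomputable def qjrd {d : ℕ} (α : ℝ) (X Y : Matrix (Fin d) (Fin d) ℂ) : ℝ :=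
  renyiEntropy α ((1 / 2 : ℝ) • (X + Y))
    - (1 / 2) * renyiEntropy α X - (1 / 2) * renyiEntropy α Y

/-- `δ_t²(X,Y) = (1/2)(1/(t+d_X) + 1/(t+d_Y)) − 1/(t + d_{(X+Y)/2})`, where `d_X = tr(X^α)`. -/
noncomputable def deltaT2 {d : ℕ} (α t : ℝ) (X Y : Matrix (Fin d) (Fin d) ℂ) : ℝ :=
  (1 / 2) * (1 / (t + traceF (fun x => x ^ α) X) + 1 / (t + traceF (fun x => x ^ α) Y))
    - 1 / (t + traceF (fun x => x ^ α) ((1 / 2 : ℝ) • (X + Y)))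

lemma traceF_rpow_pos {d : ℕ} (α : ℝ) {X : Matrix (Fin d) (Fin d) ℂ} (hX : X.PosDef)
    (htX : X.trace = 1) : 0 < traceF (fun x => x ^ α) X := by
  have : Nonempty (Fin d) := by
    by_contra h
    rw [not_nonempty_iff] at h
    simp [Matrix.trace] at htX
  rw [traceF, dif_pos hX.isHermitian]
  exact Finset.sum_pos (fun i _ => Real.rpow_pos_of_pos (hX.eigenvalues_pos i) α)
    Finset.univ_nonempty

lemma renyiEntropy_of_trace_eq_one {d : ℕ} (α : ℝ) {X : Matrix (Fin d) (Fin d) ℂ}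
    (htX : X.trace = 1) :
    renyiEntropy α X = (1 / (1 - α)) * Real.log (traceF (fun x => x ^ α) X) := by
  simp [renyiEntropy, htX]

lemma hasDerivAt_log_add_sub_log_add {a c : ℝ} (ha : 0 < a) (hc : 0 < c) {t : ℝ}
    (ht : t ∈ Set.Ici (0 : ℝ)) :
    HasDerivAt (fun t => Real.log (t + a) - Real.log (t + c)) (1 / (t + a) - 1 / (t + c)) t := by
  rw [Set.mem_Ici] at ht
  exact (((hasDerivAt_id t).add_const a).log (by simp; positivity)).sub
    (((hasDerivAt_id t).add_const c).log (by simp; positivity))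

lemma tendsto_log_add_sub_log_add (a c : ℝ) :
    Filter.Tendsto (fun t => Real.log (t + a) - Real.log (t + c)) Filter.atTop (nhds 0) := by
  simpa using! (Real.tendsto_log_comp_add_sub_log a).sub (Real.tendsto_log_comp_add_sub_log c)

lemma integrableOn_one_div_add_sub {a c : ℝ} (ha : 0 < a) (hc : 0 < c) :
    IntegrableOn (fun t => 1 / (t + a) - 1 / (t + c)) (Set.Ioi 0) := by
  rcases le_total a c with h | h
  · refine integrableOn_Ioi_deriv_of_nonneg'
      (fun t ht => hasDerivAt_log_add_sub_log_add ha hc ht) (fun t ht => ?_)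
      (tendsto_log_add_sub_log_add a c)
    rw [Set.mem_Ioi] at ht
    rw [sub_nonneg]
    gcongr
  · refine integrableOn_Ioi_deriv_of_nonpos'
      (fun t ht => hasDerivAt_log_add_sub_log_add ha hc ht) (fun t ht => ?_)
      (tendsto_log_add_sub_log_add a c)
    rw [Set.mem_Ioi] at ht
    rw [sub_nonpos]
    gcongr

lemma integral_one_div_add_sub {a c : ℝ} (ha : 0 < a) (hc : 0 < c) :
    ∫ t in Set.Ioi (0 : ℝ), (1 / (t + a) - 1 / (t + c)) = Real.log c - Real.log a := by
  rw [integral_Ioi_of_hasDerivAt_of_tendsto'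
    (fun t ht => hasDerivAt_log_add_sub_log_add ha hc ht) (integrableOn_one_div_add_sub ha hc)
    (tendsto_log_add_sub_log_add a c)]
  simp

/-- For unit-trace `X, Y ∈ ℙ_d` and `α ∈ (0,1)`:
`QJRD_α(X,Y) = (1/(1−α)) ∫₀^∞ δ_t²(X,Y) dt`. -/
theorem qjrd_eq_integral_deltaT2 {d : ℕ} (α : ℝ) (hα : α ∈ Set.Ioo (0:ℝ) 1)
    (X Y : Matrix (Fin d) (Fin d) ℂ) (hX : X.PosDef) (hY : Y.PosDef)
    (htX : X.trace = 1) (htY : Y.trace = 1) :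
    qjrd α X Y = (1 / (1 - α)) * ∫ t in Set.Ioi (0:ℝ), deltaT2 α t X Y := by
  have hZ : ((1 / 2 : ℝ) • (X + Y)).PosDef := (hX.add hY).smul (by norm_num)
  have htZ : ((1 / 2 : ℝ) • (X + Y)).trace = 1 := by
    rw [Matrix.trace_smul, Matrix.trace_add, htX, htY, Complex.real_smul]
    norm_num
  have ha := traceF_rpow_pos α hX htX
  have hb := traceF_rpow_pos α hY htY
  have hc := traceF_rpow_pos α hZ htZ
  rw [qjrd, renyiEntropy_of_trace_eq_one α htX, renyiEntropy_of_trace_eq_one α htY,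
    renyiEntropy_of_trace_eq_one α htZ]
  simp only [deltaT2]
  generalize traceF (fun x => x ^ α) X = a at *
  generalize traceF (fun x => x ^ α) Y = b at *
  generalize traceF (fun x => x ^ α) ((1 / 2 : ℝ) • (X + Y)) = c at *
  have hsplit : ∀ t : ℝ, (1 / 2) * (1 / (t + a) + 1 / (t + b)) - 1 / (t + c)
      = (1 / 2) * (1 / (t + a) - 1 / (t + c)) + (1 / 2) * (1 / (t + b) - 1 / (t + c)) :=
    fun t => by ring
  simp_rw [hsplit]
  rw [integral_add ((integrableOn_one_div_add_sub ha hc).const_mul _)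
    ((integrableOn_one_div_add_sub hb hc).const_mul _), integral_const_mul, integral_const_mul,
    integral_one_div_add_sub ha hc, integral_one_div_add_sub hb hc]
  ring
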